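/- Let n ≥ 1, let r ∈ (1,∞), and let X be a ball Banach function space over ℝⁿ such that the Hardy–Littlewood maximal operator M is bounded on X and on the Köthe dual X'. Then there exists a constant C > 0 such that for every sequence (f_j)_{j≥1} of measurable functions on ℝⁿ, ‖ (∑_{j=1}^∞ (M f_j)^r)^{1/r} ‖_X ≤ C ‖ (∑_{j=1}^∞ |f_j|^r)^{1/r} ‖_X. -/

import Mathlib

open MeasureTheory ENNReal NNReal Filter Topology

noncomputable section

/-- Euclidean space ℝⁿ. -/
abbrev Eucl (n : ℕ) := EuclideanSpace ℝ (Fin n)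

/-- The Hardy–Littlewood maximal operator
`M f (x) = sup_{r>0} r^{-n} ∫_{|y-x|<r} f`. -/
def HLM {n : ℕ} (f : Eucl n → ℝ≥0∞) (x : Eucl n) : ℝ≥0∞ :=
  ⨆ (r : ℝ) (_ : 0 < r),
    (ENNReal.ofReal (r ^ n))⁻¹ * ∫⁻ y in Metric.ball x r, f y

/-- `ρ` is a ball Banach function norm over ℝⁿ: (P1)–(P5), stated on the
nonnegative (`ℝ≥0∞`-valued) measurable functions, together with compatibility
with a.e. equality (well-definedness on `L⁰`). -/
structure IsBBFN (n : ℕ) (ρ : (Eucl n → ℝ≥0∞) → ℝ≥0∞) : Prop where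
  ae_congr : ∀ f g : Eucl n → ℝ≥0∞, f =ᵐ[volume] g → ρ f = ρ g
  zero_iff : ∀ f : Eucl n → ℝ≥0∞, Measurable f → (ρ f = 0 ↔ f =ᵐ[volume] 0)
  smul : ∀ (a : ℝ≥0) (f : Eucl n → ℝ≥0∞), Measurable f →
    ρ (fun x => (a : ℝ≥0∞) * f x) = (a : ℝ≥0∞) * ρ f
  add_le : ∀ f g : Eucl n → ℝ≥0∞, Measurable f → Measurable g →
    ρ (fun x => f x + g x) ≤ ρ f + ρ g
  mono : ∀ f g : Eucl n → ℝ≥0∞, Measurable f → Measurable g →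
    (∀ᵐ x ∂volume, f x ≤ g x) → ρ f ≤ ρ g
  fatou : ∀ (fs : ℕ → Eucl n → ℝ≥0∞) (f : Eucl n → ℝ≥0∞),
    (∀ j, Measurable (fs j)) → Measurable f →
    (∀ᵐ x ∂volume, Monotone (fun j => fs j x)) →
    (∀ᵐ x ∂volume, Tendsto (fun j => fs j x) atTop (𝓝 (f x))) →
    Tendsto (fun j => ρ (fs j)) atTop (𝓝 (ρ f))
  ball_mem : ∀ (x : Eucl n) (r : ℝ), 0 < r →
    ρ (fun y => (Metric.ball x r).indicator (fun _ => (1 : ℝ≥0∞)) y) < ⊤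
  ball_lower : ∀ (x : Eucl n) (r : ℝ), 0 < r → ∃ C : ℝ, 0 < C ∧
    ∀ f : Eucl n → ℝ≥0∞, Measurable f →
      ∫⁻ y in Metric.ball x r, f y ≤ ENNReal.ofReal C * ρ f

/-- The Köthe dual norm `ρ'(g) = sup { ∫ f·g : ρ(f) ≤ 1 }`. -/
def kdual (n : ℕ) (ρ : (Eucl n → ℝ≥0∞) → ℝ≥0∞) : (Eucl n → ℝ≥0∞) → ℝ≥0∞ :=
  fun g => ⨆ (f : Eucl n → ℝ≥0∞) (_ : Measurable f ∧ ρ f ≤ 1), ∫⁻ x, f x * g x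

/-- The Hardy–Littlewood maximal operator is bounded on the space with norm `ρ`. -/
def MBddOn (n : ℕ) (ρ : (Eucl n → ℝ≥0∞) → ℝ≥0∞) : Prop :=
  ∃ C : ℝ, 0 < C ∧ ∀ f : Eucl n → ℝ≥0∞, Measurable f →
    ρ (HLM f) ≤ ENNReal.ofReal C * ρ f


lemma HLM_open {n : ℕ} (f : Eucl n → ℝ≥0∞) (a : ℝ≥0∞) :
    IsOpen {x | a < HLM f x} := by
  rw [Metric.isOpen_iff]
  intro x hx
  simp only [HLM, Set.mem_ofPred_eq, lt_iSup_iff] at hx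
  obtain ⟨r, hr, h⟩ := hx
  have hU : Metric.ball x r = ⋃ k : ℕ, Metric.ball x (r - 1 / ((k : ℝ) + 1)) := by
    ext y
    simp only [Metric.mem_ball, Set.mem_iUnion]
    constructor
    · intro hy
      obtain ⟨k, hk⟩ := exists_nat_one_div_lt (sub_pos.2 hy)
      exact ⟨k, by linarith⟩
    · rintro ⟨k, hk⟩
      have : 0 < 1 / ((k : ℝ) + 1) := by positivity
      linarith
  have hmono : Monotone (fun k : ℕ => Metric.ball x (r - 1 / ((k : ℝ) + 1))) := by
    intro i j hij
    apply Metric.ball_subset_ball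
    have : 1 / ((j : ℝ) + 1) ≤ 1 / ((i : ℝ) + 1) := by
      apply one_div_le_one_div_of_le (by positivity)
      have : (i : ℝ) ≤ j := by exact_mod_cast hij
      linarith
    linarith
  have hS : ∫⁻ y in Metric.ball x r, f y =
      ⨆ k : ℕ, ∫⁻ y in Metric.ball x (r - 1 / ((k : ℝ) + 1)), f y := by
    have := setLIntegral_iUnion_of_directed (μ := volume) f (hmono.directed_le)
    rw [← this, ← hU]
  rw [hS, ENNReal.mul_iSup, lt_iSup_iff] at h
  obtain ⟨k, hk⟩ := h
  refine ⟨1 / ((k : ℝ) + 1), by positivity, ?_⟩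
  intro y hy
  simp only [Set.mem_ofPred_eq]
  refine hk.trans_le ?_
  refine le_trans ?_ (le_iSup₂ (f := fun (r : ℝ) (_ : 0 < r) =>
    (ENNReal.ofReal (r ^ n))⁻¹ * ∫⁻ z in Metric.ball y r, f z) r hr)
  gcongr
  apply Metric.ball_subset_ball'
  rw [Metric.mem_ball, dist_comm] at hy
  linarith

lemma HLM_meas {n : ℕ} (f : Eucl n → ℝ≥0∞) : Measurable (HLM f) :=
  measurable_of_Ioi fun a => (HLM_open f a).measurableSet

lemma HLM_tsum {n : ℕ} (f : ℕ → Eucl n → ℝ≥0∞) (hf : ∀ k, Measurable (f k)) (x : Eucl n) :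
    HLM (fun y => ∑' k, f k y) x ≤ ∑' k, HLM (f k) x := by
  refine iSup₂_le fun r hr => ?_
  rw [lintegral_tsum (fun k => (hf k).aemeasurable), ← ENNReal.tsum_mul_left]
  refine ENNReal.tsum_le_tsum fun k => ?_
  exact le_iSup₂ (f := fun (r : ℝ) (_ : 0 < r) =>
    (ENNReal.ofReal (r ^ n))⁻¹ * ∫⁻ z in Metric.ball x r, f k z) r hr

lemma HLM_smul {n : ℕ} (c : ℝ≥0∞) (f : Eucl n → ℝ≥0∞) (hf : Measurable f) (x : Eucl n) :
    HLM (fun y => c * f y) x = c * HLM f x := by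
  simp only [HLM, ENNReal.mul_iSup]
  refine iSup_congr fun r => iSup_congr fun hr => ?_
  rw [lintegral_const_mul _ hf]; ring

lemma HLM_pos {n : ℕ} (f : Eucl n → ℝ≥0∞) (hf : Measurable f) (h0 : ¬ f =ᵐ[volume] 0)
    (x : Eucl n) : 0 < HLM f x := by
  by_contra hc
  apply h0
  have h1 : HLM f x = 0 := by simpa using hc
  have h2 : ∀ k : ℕ, ∫⁻ y in Metric.ball x ((k:ℝ)+1), f y = 0 := by
    intro k
    have hp : (0:ℝ) < (k:ℝ)+1 := by positivity
    have := le_iSup₂ (f := fun (r : ℝ) (_ : 0 < r) =>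
      (ENNReal.ofReal (r ^ n))⁻¹ * ∫⁻ z in Metric.ball x r, f z) _ hp
    have h3 : (ENNReal.ofReal (((k:ℝ)+1) ^ n))⁻¹ * ∫⁻ z in Metric.ball x ((k:ℝ)+1), f z = 0 :=
      le_antisymm (this.trans h1.le) bot_le
    rcases mul_eq_zero.1 h3 with h | h
    · simp at h
    · exact h
  have h3 : ∀ k : ℕ, ∀ᵐ y ∂volume, y ∈ Metric.ball x ((k:ℝ)+1) → f y = 0 := by
    intro k
    have := (lintegral_eq_zero_iff hf).1 (h2 k)
    exact (ae_restrict_iff' measurableSet_ball).1 this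
  filter_upwards [ae_all_iff.2 h3] with y hy
  obtain ⟨k, hk⟩ := exists_nat_gt (dist y x)
  exact hy k (by rw [Metric.mem_ball]; linarith)

/-- Rubio de Francia iterates. -/
lemma rubio {n : ℕ} (N : (Eucl n → ℝ≥0∞) → ℝ≥0∞)
    (hsub : ∀ g : ℕ → Eucl n → ℝ≥0∞, (∀ k, Measurable (g k)) →
      N (fun x => ∑' k, g k x) ≤ ∑' k, N (g k))
    (hsmul : ∀ (a : ℝ≥0) (g : Eucl n → ℝ≥0∞), Measurable g →
      N (fun x => (a : ℝ≥0∞) * g x) = a * N g)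
    (C : ℝ) (hC : 0 < C)
    (hM : ∀ f : Eucl n → ℝ≥0∞, Measurable f → N (HLM f) ≤ ENNReal.ofReal C * N f)
    (g : Eucl n → ℝ≥0∞) (hg : Measurable g) (h0 : ¬ g =ᵐ[volume] 0) :
    ∃ u : Eucl n → ℝ≥0∞, Measurable u ∧ (∀ x, g x ≤ u x) ∧ (∀ x, 0 < u x) ∧
      N u ≤ 2 * N g ∧ ∀ x, HLM u x ≤ ENNReal.ofReal (2 * C) * u x := by
  let c : ℝ≥0 := Real.toNNReal (2 * C)
  have hc : 0 < c := by simpa [c] using hC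
  have hc0 : (c : ℝ≥0∞) ≠ 0 := by exact_mod_cast hc.ne'
  have hcC : ENNReal.ofReal (2*C) = c := rfl
  have hc2 : (c : ℝ≥0∞) = 2 * ENNReal.ofReal C := by
    rw [← hcC, ENNReal.ofReal_mul (by norm_num)]; simp
  have hit : ∀ k, Measurable (HLM^[k] g) := by
    intro k
    cases k with
    | zero => simpa using hg
    | succ k => rw [Function.iterate_succ_apply']; exact HLM_meas _
  have hN : ∀ k, N (HLM^[k] g) ≤ ENNReal.ofReal C ^ k * N g := by
    intro k
    induction k with
    | zero => simp
    | succ k ih =>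
      rw [Function.iterate_succ_apply']
      refine (hM _ (hit k)).trans ?_
      calc _ ≤ ENNReal.ofReal C * (ENNReal.ofReal C ^ k * N g) := by gcongr
        _ = _ := by ring
  have hkey : ∀ x k, (((c⁻¹ ^ k : ℝ≥0) : ℝ≥0∞) * HLM^[k] g x) ≤
      ∑' k, ((c⁻¹ ^ k : ℝ≥0) : ℝ≥0∞) * HLM^[k] g x := fun x k =>
    ENNReal.le_tsum (f := fun k => (((c⁻¹ ^ k : ℝ≥0) : ℝ≥0∞) * HLM^[k] g x)) k
  refine ⟨fun x => ∑' k, ((c⁻¹ ^ k : ℝ≥0) : ℝ≥0∞) * HLM^[k] g x, ?_, ?_, ?_, ?_, ?_⟩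
  · exact Measurable.tsum fun k => (hit k).const_mul _
  · intro x
    simpa using hkey x 0
  · intro x
    refine lt_of_lt_of_le ?_ (hkey x 1)
    have := HLM_pos g hg h0 x
    refine ENNReal.mul_pos ?_ (by simpa using this.ne')
    simp [hc.ne']
  · refine (hsub _ fun k => (hit k).const_mul _).trans ?_
    calc _ ≤ ∑' k : ℕ, (2⁻¹ : ℝ≥0∞) ^ k * N g := by
          refine ENNReal.tsum_le_tsum fun k => ?_
          rw [hsmul _ _ (hit k)]
          calc _ ≤ ((c⁻¹ ^ k : ℝ≥0) : ℝ≥0∞) * (ENNReal.ofReal C ^ k * N g) := by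
                gcongr; exact hN k
            _ = _ := by
                rw [← mul_assoc]
                congr 1
                rw [ENNReal.coe_pow, ← mul_pow, ENNReal.coe_inv hc.ne', hc2,
                  ENNReal.mul_inv (by simp) (by simp), mul_assoc,
                  ENNReal.inv_mul_cancel (by simpa using hC) (by simp), mul_one]
      _ = 2 * N g := by
          rw [ENNReal.tsum_mul_right, ENNReal.tsum_geometric]
          simp
  · intro x
    refine (HLM_tsum _ (fun k => (hit k).const_mul _) x).trans ?_
    rw [hcC, ← ENNReal.tsum_mul_left]
    calc _ ≤ ∑' k : ℕ, (c : ℝ≥0∞) * (((c⁻¹ ^ (k+1) : ℝ≥0) : ℝ≥0∞) * HLM^[k+1] g x) := by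
          refine ENNReal.tsum_le_tsum fun k => ?_
          rw [HLM_smul _ _ (hit k), Function.iterate_succ_apply', ← mul_assoc]
          apply le_of_eq
          congr 1
          norm_cast
          rw [pow_succ']
          field_simp
      _ ≤ _ := ENNReal.tsum_comp_le_tsum_of_injective (add_left_injective 1)
          (fun k => (c : ℝ≥0∞) * (((c⁻¹ ^ k : ℝ≥0) : ℝ≥0∞) * HLM^[k] g x))

/-- Uncentered maximal function with respect to a measure. -/
def MM {n : ℕ} (μ : Measure (Eucl n)) (f : Eucl n → ℝ≥0∞) (x : Eucl n) : ℝ≥0∞ :=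
  ⨆ (c : Eucl n) (s : ℝ) (_ : 0 < s) (_ : x ∈ Metric.ball c s),
    (μ (Metric.ball c s))⁻¹ * ∫⁻ y in Metric.ball c s, f y ∂μ

lemma le_MM {n : ℕ} (μ : Measure (Eucl n)) (f : Eucl n → ℝ≥0∞) (x c : Eucl n) (s : ℝ)
    (hs : 0 < s) (hx : x ∈ Metric.ball c s) :
    (μ (Metric.ball c s))⁻¹ * ∫⁻ y in Metric.ball c s, f y ∂μ ≤ MM μ f x := by
  unfold MM
  exact le_iSup_of_le c (le_iSup_of_le s (le_iSup_of_le hs (le_iSup_of_le hx le_rfl)))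

lemma MM_lt_iff {n : ℕ} (μ : Measure (Eucl n)) (f : Eucl n → ℝ≥0∞) (x : Eucl n) (a : ℝ≥0∞) :
    a < MM μ f x ↔ ∃ c s, 0 < s ∧ x ∈ Metric.ball c s ∧
      a < (μ (Metric.ball c s))⁻¹ * ∫⁻ y in Metric.ball c s, f y ∂μ := by
  simp only [MM, lt_iSup_iff, exists_prop]

lemma MM_meas {n : ℕ} (μ : Measure (Eucl n)) (f : Eucl n → ℝ≥0∞) : Measurable (MM μ f) := by
  refine measurable_of_Ioi fun a => IsOpen.measurableSet ?_
  rw [isOpen_iff_mem_nhds]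
  intro x hx
  obtain ⟨c, s, hs, hxs, h⟩ := (MM_lt_iff μ f x a).1 hx
  filter_upwards [Metric.isOpen_ball.mem_nhds hxs] with y hy
  exact (MM_lt_iff μ f y a).2 ⟨c, s, hs, hy, h⟩

lemma MM_weak {n : ℕ} (μ : Measure (Eucl n)) (D : ℝ≥0∞)
    (hpos : ∀ c s, 0 < s → μ (Metric.ball c s) ≠ 0)
    (hfin : ∀ c s, μ (Metric.ball c s) ≠ ⊤)
    (hD : ∀ c s, 0 < s → μ (Metric.ball c (5 * s)) ≤ D * μ (Metric.ball c s))
    (f : Eucl n → ℝ≥0∞) (a : ℝ≥0∞) :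
    a * μ {x | a < MM μ f x} ≤ D * ∫⁻ y, f y ∂μ := by
  let T : ℕ → Set (Eucl n × ℝ) := fun N => {q | 0 < q.2 ∧ q.2 ≤ N ∧
      a < (μ (Metric.ball q.1 q.2))⁻¹ * ∫⁻ y in Metric.ball q.1 q.2, f y ∂μ}
  have hU : {x | a < MM μ f x} = ⋃ N, ⋃ q ∈ T N, Metric.ball q.1 q.2 := by
    ext x
    simp only [Set.mem_ofPred_eq, MM_lt_iff, Set.mem_iUnion, T]
    constructor
    · rintro ⟨c, s, hs, hx, h⟩
      obtain ⟨N, hN⟩ := exists_nat_ge s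
      exact ⟨N, (c, s), ⟨hs, hN, h⟩, hx⟩
    · rintro ⟨N, ⟨c, s⟩, ⟨hs, hN, h⟩, hx⟩
      exact ⟨c, s, hs, hx, h⟩
  have hmono : Monotone fun N => ⋃ q ∈ T N, Metric.ball q.1 q.2 := by
    intro N N' hN
    refine Set.biUnion_subset_biUnion_left ?_
    rintro q ⟨h1, h2, h3⟩
    exact ⟨h1, h2.trans (by exact_mod_cast hN), h3⟩
  rw [hU, hmono.directed_le.measure_iUnion, ENNReal.mul_iSup]
  refine iSup_le fun N => ?_
  obtain ⟨u, hut, hdis, hcov⟩ := Vitali.exists_disjoint_subfamily_covering_enlargement_closedBall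
    (T N) (fun q => q.1) (fun q => q.2) N (fun q hq => hq.2.1) 4 (by norm_num)
  have hdis' : u.PairwiseDisjoint fun q => Metric.ball q.1 q.2 :=
    hdis.mono fun q => Metric.ball_subset_closedBall
  have hcount : u.Countable := by
    refine hdis'.countable_of_nonempty_interior fun q hq => ?_
    rw [Metric.isOpen_ball.interior_eq]
    exact Metric.nonempty_ball.2 (hut hq).1
  have hsub : (⋃ q ∈ T N, Metric.ball q.1 q.2) ⊆ ⋃ q ∈ u, Metric.ball q.1 (5 * q.2) := by
    refine Set.iUnion₂_subset fun q hq => ?_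
    obtain ⟨b, hb, h⟩ := hcov q hq
    refine Set.Subset.trans ?_ (Set.subset_biUnion_of_mem (u := fun b : Eucl n × ℝ => Metric.ball b.1 (5 * b.2)) hb)
    refine Metric.ball_subset_closedBall.trans (h.trans (Metric.closedBall_subset_ball ?_))
    have := (hut hb).1
    linarith
  calc a * μ (⋃ q ∈ T N, Metric.ball q.1 q.2)
      ≤ a * ∑' q : u, μ (Metric.ball q.1.1 (5 * q.1.2)) := by
        gcongr
        exact (measure_mono hsub).trans (measure_biUnion_le μ hcount _)
    _ ≤ a * ∑' q : u, D * μ (Metric.ball q.1.1 q.1.2) := by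
        gcongr with q
        exact hD _ _ (hut q.2).1
    _ = D * ∑' q : u, a * μ (Metric.ball q.1.1 q.1.2) := by
        rw [ENNReal.tsum_mul_left, ENNReal.tsum_mul_left]; ring
    _ ≤ D * ∑' q : u, ∫⁻ y in Metric.ball q.1.1 q.1.2, f y ∂μ := by
        gcongr with q
        have h := (hut q.2).2.2.le
        rw [← ENNReal.div_eq_inv_mul] at h
        rwa [ENNReal.le_div_iff_mul_le (Or.inl (hpos _ _ (hut q.2).1)) (Or.inl (hfin _ _))] at h
    _ = D * ∫⁻ y in ⋃ q ∈ u, Metric.ball q.1 q.2, f y ∂μ := by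
        rw [lintegral_biUnion hcount (fun q _ => measurableSet_ball) hdis']
    _ ≤ D * ∫⁻ y, f y ∂μ := by
        exact mul_le_mul_right (setLIntegral_le_lintegral _ _) _

lemma MM_split {n : ℕ} (μ : Measure (Eucl n))
    (f : Eucl n → ℝ≥0∞) (a : ℝ≥0∞) (x : Eucl n) :
    MM μ f x ≤ MM μ ({y | a < f y}.indicator f) x + a := by
  refine iSup_le fun c => iSup_le fun s => iSup_le fun hs => iSup_le fun hx => ?_
  calc (μ (Metric.ball c s))⁻¹ * ∫⁻ y in Metric.ball c s, f y ∂μ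
      ≤ (μ (Metric.ball c s))⁻¹ * ∫⁻ y in Metric.ball c s, ({y | a < f y}.indicator f y + a) ∂μ := by
        gcongr with y
        by_cases h : a < f y
        · simp [Set.indicator, h]
        · have h' := not_lt.1 h
          simpa [Set.indicator, h] using h'
    _ = (μ (Metric.ball c s))⁻¹ * ∫⁻ y in Metric.ball c s, ({y | a < f y}.indicator f y) ∂μ
          + (μ (Metric.ball c s))⁻¹ * (a * μ (Metric.ball c s)) := by
        rw [lintegral_add_right _ measurable_const, mul_add]
        simp
    _ ≤ _ := by
        gcongr
        · exact le_MM μ _ x c s hs hx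
        · rw [mul_comm, mul_assoc]
          exact mul_le_of_le_one_right bot_le (ENNReal.mul_inv_le_one _)

lemma layer_fin (p : ℝ) (hp : 0 < p) (t : ℝ) (ht : 0 ≤ t) :
    ∫⁻ l in Set.Ioo (0:ℝ) t, ENNReal.ofReal (l ^ (p - 1)) = ENNReal.ofReal (t ^ p / p) := by
  have h1 : IntervalIntegrable (fun l : ℝ => l ^ (p - 1)) volume 0 t :=
    intervalIntegral.intervalIntegrable_rpow' (by linarith)
  have h2 := integral_rpow (a := 0) (b := t) (r := p - 1) (Or.inl (by linarith))
  rw [intervalIntegral.integral_of_le ht] at h2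
  rw [intervalIntegrable_iff_integrableOn_Ioc_of_le ht] at h1
  rw [← restrict_Ioo_eq_restrict_Ioc] at h2
  have h3 := h1.mono_set Set.Ioo_subset_Ioc_self
  rw [← ofReal_integral_eq_lintegral_ofReal h3, h2]
  · congr 1
    simp [Real.zero_rpow hp.ne']
  · filter_upwards [ae_restrict_mem measurableSet_Ioo] with l hl
    exact Real.rpow_nonneg hl.1.le _

lemma layer_le (p : ℝ) (hp : 0 < p) (a : ℝ≥0∞) :
    ∫⁻ l in Set.Ioi (0:ℝ), {l : ℝ | ENNReal.ofReal l < a}.indicator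
      (fun l => ENNReal.ofReal (l ^ (p - 1))) l = ENNReal.ofReal (1/p) * a ^ p := by
  have hm : ∀ a : ℝ≥0∞, MeasurableSet {l : ℝ | ENNReal.ofReal l < a} := fun a =>
    measurableSet_lt ENNReal.measurable_ofReal measurable_const
  have hfin : ∀ t : ℝ, 0 ≤ t → ∫⁻ l in Set.Ioi (0:ℝ), {l : ℝ | ENNReal.ofReal l < ENNReal.ofReal t}.indicator
      (fun l => ENNReal.ofReal (l ^ (p - 1))) l = ENNReal.ofReal (1/p) * ENNReal.ofReal t ^ p := by
    intro t ht
    rw [setLIntegral_indicator (hm _)]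
    have : {l : ℝ | ENNReal.ofReal l < ENNReal.ofReal t} ∩ Set.Ioi 0 = Set.Ioo 0 t := by
      ext l
      simp only [Set.mem_inter_iff, Set.mem_ofPred_eq, Set.mem_Ioi, Set.mem_Ioo]
      constructor
      · rintro ⟨h1, h2⟩
        exact ⟨h2, (ENNReal.ofReal_lt_ofReal_iff_of_nonneg h2.le).1 h1⟩
      · rintro ⟨h1, h2⟩
        exact ⟨(ENNReal.ofReal_lt_ofReal_iff_of_nonneg h1.le).2 h2, h1⟩
    rw [this, layer_fin p hp t ht, ENNReal.ofReal_rpow_of_nonneg ht hp.le,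
      ← ENNReal.ofReal_mul (by positivity)]
    congr 1; ring
  by_cases ha : a = ⊤
  · subst ha
    rw [ENNReal.top_rpow_of_pos hp, ENNReal.mul_top (by simpa using hp)]
    rw [eq_top_iff]
    refine le_of_tendsto' (x := atTop) (f := fun N : ℕ => ENNReal.ofReal (1/p) * ENNReal.ofReal (N:ℝ) ^ p)
      ?_ ?_
    · have h1 : Tendsto (fun N : ℕ => ENNReal.ofReal (N:ℝ) ^ p) atTop (𝓝 ⊤) := by
        have := (ENNReal.continuous_rpow_const (y := p)).tendsto ⊤
        rw [ENNReal.top_rpow_of_pos hp] at this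
        refine this.comp ?_
        simpa using ENNReal.tendsto_nat_nhds_top
      have h2 := ENNReal.Tendsto.const_mul (a := ENNReal.ofReal (1/p)) h1 (Or.inl (by simp))
      rwa [ENNReal.mul_top (by simpa using hp)] at h2
    · intro N
      rw [← hfin N (by positivity)]
      refine lintegral_mono fun l => ?_
      refine Set.indicator_le_indicator_of_subset ?_ (fun _ => bot_le) _
      intro l _
      simp
  · have := hfin a.toReal ENNReal.toReal_nonneg
    rwa [ENNReal.ofReal_toReal ha] at this

lemma MM_strong (D : ℝ≥0∞) (hDt : D ≠ ⊤) (p : ℝ) (hp : 1 < p) :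
    ∃ C : ℝ≥0∞, C ≠ ⊤ ∧ ∀ {n : ℕ} (μ : Measure (Eucl n)), SFinite μ →
    (∀ c s, 0 < s → μ (Metric.ball c s) ≠ 0) →
    (∀ c s, μ (Metric.ball c s) ≠ ⊤) →
    (∀ c s, 0 < s → μ (Metric.ball c (5 * s)) ≤ D * μ (Metric.ball c s)) →
    ∀ (f : Eucl n → ℝ≥0∞), Measurable f →
    ∫⁻ x, MM μ f x ^ p ∂μ ≤ C * ∫⁻ x, f x ^ p ∂μ := by
  refine ⟨ENNReal.ofReal p * (2 * D * (ENNReal.ofReal (1/(p-1)) * 2 ^ (p-1))), ?_, ?_⟩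
  · have : (2:ℝ≥0∞) ^ (p-1) ≠ ⊤ := ENNReal.rpow_ne_top_of_nonneg (by linarith) (by simp)
    finiteness
  intro n μ hμ hpos hfin hD f hf
  have hp0 : 0 < p := by linarith
  have hM := MM_meas μ f
  -- half-level weak type
  have hweak : ∀ l : ℝ, 0 < l → ENNReal.ofReal l * μ {x | ENNReal.ofReal l < MM μ f x} ≤
      2 * D * ∫⁻ y, {y | ENNReal.ofReal l < 2 * f y}.indicator f y ∂μ := by
    intro l hl
    set a := ENNReal.ofReal (l/2) with ha
    have hla : ENNReal.ofReal l = 2 * a := by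
      rw [ha, ← ENNReal.ofReal_ofNat, ← ENNReal.ofReal_mul (by norm_num)]
      congr 1; ring
    have h1 := MM_weak μ D hpos hfin hD ({y | a < f y}.indicator f) a
    have h2 : {x | ENNReal.ofReal l < MM μ f x} ⊆ {x | a < MM μ ({y | a < f y}.indicator f) x} := by
      intro x hx
      have h3 := MM_split μ f a x
      simp only [Set.mem_ofPred_eq] at hx ⊢
      by_contra hc
      push Not at hc
      have : ENNReal.ofReal l < a + a := hx.trans_le (h3.trans (by gcongr))
      rw [hla, two_mul] at this
      exact lt_irrefl _ this
    have h4 : {y | ENNReal.ofReal l < 2 * f y} = {y | a < f y} := by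
      ext y
      simp only [Set.mem_ofPred_eq, hla]
      rw [ENNReal.mul_lt_mul_iff_right (by simp) (by simp)]
    rw [h4, hla]
    calc _ ≤ 2 * (a * μ {x | a < MM μ ({y | a < f y}.indicator f) x}) := by
          rw [mul_assoc]
          rw [hla] at h2
          have h5 : μ _ ≤ μ _ := measure_mono h2
          exact mul_le_mul_right (mul_le_mul_right h5 _) _
      _ ≤ 2 * (D * ∫⁻ y, {y | a < f y}.indicator f y ∂μ) := by gcongr
      _ = _ := by ring
  have hrp : Measurable fun l : ℝ => ENNReal.ofReal (l ^ (p-1)) := by fun_prop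
  have hrp2 : Measurable fun l : ℝ => ENNReal.ofReal (l ^ (p-1-1)) := by fun_prop
  have e1 : ∀ x, MM μ f x ^ p = ENNReal.ofReal p * ∫⁻ l in Set.Ioi (0:ℝ), {l : ℝ | ENNReal.ofReal l < MM μ f x}.indicator
      (fun l => ENNReal.ofReal (l ^ (p - 1))) l := by
    intro x
    rw [layer_le p hp0, ← mul_assoc, ← ENNReal.ofReal_mul hp0.le, mul_one_div_cancel hp0.ne']
    simp
  have m1 : Measurable (fun z : Eucl n × ℝ => {l : ℝ | ENNReal.ofReal l < MM μ f z.1}.indicator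
      (fun l => ENNReal.ofReal (l ^ (p - 1))) z.2) := by
    have : (fun z : Eucl n × ℝ => {l : ℝ | ENNReal.ofReal l < MM μ f z.1}.indicator
      (fun l => ENNReal.ofReal (l ^ (p - 1))) z.2) =
      {z : Eucl n × ℝ | ENNReal.ofReal z.2 < MM μ f z.1}.indicator
        (fun z => ENNReal.ofReal (z.2 ^ (p - 1))) := by
      ext z; simp [Set.indicator]
    rw [this]
    exact (hrp.comp measurable_snd).indicator
      (measurableSet_lt (ENNReal.measurable_ofReal.comp measurable_snd) (hM.comp measurable_fst))
  have m2 : Measurable (fun z : ℝ × Eucl n => ENNReal.ofReal (z.1 ^ (p-1-1)) *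
      {y | ENNReal.ofReal z.1 < 2 * f y}.indicator f z.2) := by
    have : (fun z : ℝ × Eucl n => ENNReal.ofReal (z.1 ^ (p-1-1)) *
      {y | ENNReal.ofReal z.1 < 2 * f y}.indicator f z.2) =
      fun z => ENNReal.ofReal (z.1 ^ (p-1-1)) *
        {z : ℝ × Eucl n | ENNReal.ofReal z.1 < 2 * f z.2}.indicator
        (fun z => f z.2) z := by
      ext z; simp [Set.indicator]
    rw [this]
    exact (hrp2.comp measurable_fst).mul ((hf.comp measurable_snd).indicator
      (measurableSet_lt (ENNReal.measurable_ofReal.comp measurable_fst) ((hf.comp measurable_snd).const_mul _)))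
  calc ∫⁻ x, MM μ f x ^ p ∂μ
      = ENNReal.ofReal p * ∫⁻ x, (∫⁻ l in Set.Ioi (0:ℝ), {l : ℝ | ENNReal.ofReal l < MM μ f x}.indicator
          (fun l => ENNReal.ofReal (l ^ (p - 1))) l) ∂μ := by
        simp_rw [e1]
        rw [lintegral_const_mul]
        exact m1.lintegral_prod_right'
    _ = ENNReal.ofReal p * ∫⁻ l in Set.Ioi (0:ℝ), ∫⁻ x, {l : ℝ | ENNReal.ofReal l < MM μ f x}.indicator
          (fun l => ENNReal.ofReal (l ^ (p - 1))) l ∂μ := by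
        rw [lintegral_lintegral_swap]
        exact m1.aemeasurable
    _ ≤ ENNReal.ofReal p * ∫⁻ l in Set.Ioi (0:ℝ), (2 * D) * ∫⁻ y, ENNReal.ofReal (l ^ (p-1-1)) *
          {y | ENNReal.ofReal l < 2 * f y}.indicator f y ∂μ := by
        refine mul_le_mul_right (setLIntegral_mono' measurableSet_Ioi fun l hl => ?_) _
        have hl0 : (0:ℝ) < l := hl
        have i1 : ∀ x, {l : ℝ | ENNReal.ofReal l < MM μ f x}.indicator
          (fun l => ENNReal.ofReal (l ^ (p - 1))) l = ENNReal.ofReal (l ^ (p - 1)) *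
            {x | ENNReal.ofReal l < MM μ f x}.indicator 1 x := by
          intro x; simp [Set.indicator]
        simp_rw [i1]
        have hms : MeasurableSet {x | ENNReal.ofReal l < MM μ f x} := measurableSet_lt measurable_const hM
        rw [lintegral_const_mul _ (measurable_one.indicator hms), lintegral_indicator_one hms,
          lintegral_const_mul' _ _ (by simp)]
        have : ENNReal.ofReal (l ^ (p-1)) = ENNReal.ofReal (l ^ (p-1-1)) * ENNReal.ofReal l := by
          rw [← ENNReal.ofReal_mul (by positivity)]
          congr 1
          rw [Real.rpow_sub_one hl0.ne' (p-1), div_mul_cancel₀ _ hl0.ne']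
        rw [this, mul_assoc]
        calc _ ≤ ENNReal.ofReal (l ^ (p-1-1)) * (2 * D * ∫⁻ y, {y | ENNReal.ofReal l < 2 * f y}.indicator f y ∂μ) := by
              exact mul_le_mul_right (hweak l hl0) _
          _ = _ := by ring
    _ = ENNReal.ofReal p * ((2 * D) * ∫⁻ y, (∫⁻ l in Set.Ioi (0:ℝ), ENNReal.ofReal (l ^ (p-1-1)) *
          {y | ENNReal.ofReal l < 2 * f y}.indicator f y) ∂μ) := by
        rw [lintegral_const_mul _ m2.lintegral_prod_right', lintegral_lintegral_swap]
        exact m2.aemeasurable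
    _ = ENNReal.ofReal p * ((2 * D) * ∫⁻ y, (ENNReal.ofReal (1/(p-1)) * 2 ^ (p-1)) * f y ^ p ∂μ) := by
        congr 2
        refine lintegral_congr fun y => ?_
        have i1 : ∀ l : ℝ, ENNReal.ofReal (l ^ (p-1-1)) *
          {y | ENNReal.ofReal l < 2 * f y}.indicator f y = 
          {l : ℝ | ENNReal.ofReal l < 2 * f y}.indicator (fun l => ENNReal.ofReal (l ^ (p-1-1))) l * f y := by
          intro l; simp [Set.indicator]
        simp_rw [i1]
        rw [lintegral_mul_const, layer_le (p-1) (by linarith), ENNReal.mul_rpow_of_nonneg _ _ (by linarith),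
          mul_assoc, mul_assoc, mul_assoc]
        · congr 2
          conv_rhs => rw [show p = (p - 1) + 1 by ring]
          rw [ENNReal.rpow_add_of_nonneg _ _ (by linarith) (by norm_num)]
          simp
        · exact hrp2.indicator (measurableSet_lt ENNReal.measurable_ofReal measurable_const)
    _ = _ := by
        rw [lintegral_const_mul _ (by fun_prop)]
        ring

lemma int_ball_ne_zero {n : ℕ} (w : Eucl n → ℝ≥0∞) (hw : Measurable w)
    (h : ∀ᵐ x, w x ≠ 0) (c : Eucl n) (s : ℝ) (hs : 0 < s) :
    ∫⁻ y in Metric.ball c s, w y ≠ 0 := by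
  intro h0
  have h1 := (lintegral_eq_zero_iff hw).1 h0
  have h2 : ∀ᵐ x ∂(volume.restrict (Metric.ball c s)), False := by
    filter_upwards [h1, ae_restrict_of_ae h] with x h3 h4 using h4 h3
  rw [Filter.eventually_false_iff_eq_bot, ae_eq_bot, Measure.restrict_eq_zero] at h2
  exact (Metric.measure_ball_pos volume c hs).ne' h2

lemma vol_ball {n : ℕ} (c : Eucl n) (s : ℝ) (hs : 0 < s) :
    volume (Metric.ball c s) = ENNReal.ofReal (s ^ n) * volume (Metric.ball (0 : Eucl n) 1) := by
  have := Measure.addHaar_ball_of_pos (volume : Measure (Eucl n)) c hs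
  simpa using this

lemma muck (n : ℕ) (r : ℝ) (hr : 1 < r) (K : ℝ≥0∞) (hK : K ≠ ⊤) :
    ∃ C : ℝ≥0∞, C ≠ ⊤ ∧ ∀ w : Eucl n → ℝ≥0∞, Measurable w →
      (∀ᵐ x, w x ≠ 0 ∧ w x ≠ ⊤) →
      (∀ c s, 0 < s → (∫⁻ y in Metric.ball c s, w y) *
        (∫⁻ y in Metric.ball c s, w y ^ (-(1/(r-1)))) ^ (r-1) ≤ K * ENNReal.ofReal (s^n) ^ r) →
      ∀ f : Eucl n → ℝ≥0∞, Measurable f →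
        ∫⁻ x, HLM f x ^ r * w x ≤ C * ∫⁻ x, f x ^ r * w x := by
  have hq : 0 < r - 1 := by linarith
  have hr0 : 0 < r := by linarith
  set q := r - 1 with hqdef
  have hrq : 1 < r / q := by rw [lt_div_iff₀ hq]; linarith
  set cB := volume (Metric.ball (0 : Eucl n) 1) with hcB
  have hcB0 : cB ≠ 0 := (Metric.measure_ball_pos volume _ one_pos).ne'
  have hcBt : cB ≠ ⊤ := measure_ball_lt_top.ne
  set D := K * ENNReal.ofReal (5^n) ^ r * cB⁻¹ ^ r with hDdef
  have hDt : D ≠ ⊤ := by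
    have h1 : ENNReal.ofReal (5^n) ^ r ≠ ⊤ := ENNReal.rpow_ne_top_of_nonneg hr0.le (by simp)
    have h2 : cB⁻¹ ^ r ≠ ⊤ := ENNReal.rpow_ne_top_of_nonneg hr0.le (by simpa using hcB0)
    finiteness
  obtain ⟨C1, hC1, H1⟩ := MM_strong D hDt (r/q) hrq
  obtain ⟨C2, hC2, H2⟩ := MM_strong (D ^ (1/q)) (ENNReal.rpow_ne_top_of_nonneg (by positivity) hDt) r hr
  refine ⟨(K * cB⁻¹) ^ (r/q) * C1 * C2, ?_, ?_⟩
  · have : (K * cB⁻¹) ^ (r/q) ≠ ⊤ := ENNReal.rpow_ne_top_of_nonneg (by positivity)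
      (ENNReal.mul_ne_top hK (by simpa using hcB0))
    finiteness
  intro w hw hae hA f hf
  set σ : Eucl n → ℝ≥0∞ := fun y => w y ^ (-(1/q)) with hσdef
  have hσ : Measurable σ := by fun_prop
  have hσae : ∀ᵐ x, σ x ≠ 0 ∧ σ x ≠ ⊤ := by
    filter_upwards [hae] with x hx
    constructor
    · exact (ENNReal.rpow_pos (pos_iff_ne_zero.2 hx.1) hx.2).ne'
    · exact ENNReal.rpow_ne_top_of_ne_zero hx.1 hx.2
  set μw := (volume : Measure (Eucl n)).withDensity w with hμw
  set μσ := (volume : Measure (Eucl n)).withDensity σ with hμσ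
  have ew : ∀ c s, μw (Metric.ball c s) = ∫⁻ y in Metric.ball c s, w y := fun c s =>
    withDensity_apply _ measurableSet_ball
  have eσ : ∀ c s, μσ (Metric.ball c s) = ∫⁻ y in Metric.ball c s, σ y := fun c s =>
    withDensity_apply _ measurableSet_ball
  have hA' : ∀ c s, 0 < s → μw (Metric.ball c s) * μσ (Metric.ball c s) ^ q ≤
      K * ENNReal.ofReal (s^n) ^ r := by
    intro c s hs; rw [ew, eσ]; exact hA c s hs
  have w0 : ∀ c s, 0 < s → μw (Metric.ball c s) ≠ 0 := by
    intro c s hs; rw [ew]; exact int_ball_ne_zero w hw (hae.mono fun x h => h.1) c s hs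
  have σ0 : ∀ c s, 0 < s → μσ (Metric.ball c s) ≠ 0 := by
    intro c s hs; rw [eσ]; exact int_ball_ne_zero σ hσ (hσae.mono fun x h => h.1) c s hs
  have hRt : ∀ s : ℝ, K * ENNReal.ofReal (s^n) ^ r ≠ ⊤ := fun s =>
    ENNReal.mul_ne_top hK (ENNReal.rpow_ne_top_of_nonneg hr0.le (by simp))
  have wt : ∀ c s, μw (Metric.ball c s) ≠ ⊤ := by
    intro c s
    by_cases hs : 0 < s
    · intro h
      have := hA' c s hs
      rw [h, ENNReal.top_mul] at this
      · exact hRt s (top_le_iff.1 this)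
      · intro h'
        rw [ENNReal.rpow_eq_zero_iff_of_pos hq] at h'
        exact σ0 c s hs h'
    · rw [Metric.ball_eq_empty.2 (not_lt.1 hs)]; simp
  have σt : ∀ c s, μσ (Metric.ball c s) ≠ ⊤ := by
    intro c s
    by_cases hs : 0 < s
    · intro h
      have := hA' c s hs
      rw [h, ENNReal.top_rpow_of_pos hq, ENNReal.mul_top (w0 c s hs)] at this
      exact hRt s (top_le_iff.1 this)
    · rw [Metric.ball_eq_empty.2 (not_lt.1 hs)]; simp
  have hol : ∀ c s, volume (Metric.ball c s) ^ r ≤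
      μw (Metric.ball c s) * μσ (Metric.ball c s) ^ q := by
    intro c s
    have hc := Real.HolderConjugate.conjExponent hr
    have h1 := ENNReal.lintegral_mul_le_Lp_mul_Lq (volume.restrict (Metric.ball c s)) hc
      (f := fun y => w y ^ (1/r)) (g := fun y => w y ^ (-(1/r))) (by fun_prop) (by fun_prop)
    have h2 : ∫⁻ y in Metric.ball c s, ((fun y => w y ^ (1/r)) * (fun y => w y ^ (-(1/r)))) y =
        volume (Metric.ball c s) := by
      rw [← setLIntegral_one]
      refine lintegral_congr_ae (ae_restrict_of_ae ?_)
      filter_upwards [hae] with y hy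
      simp only [Pi.mul_apply]
      rw [← ENNReal.rpow_add _ _ hy.1 hy.2]
      simp
    rw [h2] at h1
    have h3 : ∀ y, (w y ^ (1/r)) ^ r = w y := by
      intro y; rw [← ENNReal.rpow_mul]; simp [hr0.ne']
    have h4 : ∀ y, (w y ^ (-(1/r))) ^ (r.conjExponent) = σ y := by
      intro y; rw [← ENNReal.rpow_mul, hσdef]
      congr 1
      rw [Real.conjExponent, ← hqdef]; field_simp
    simp only [h3, h4] at h1
    rw [ew, eσ]
    calc _ ≤ _ := ENNReal.rpow_le_rpow h1 hr0.le
      _ = _ := by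
        rw [ENNReal.mul_rpow_of_nonneg _ _ hr0.le, ← ENNReal.rpow_mul, ← ENNReal.rpow_mul]
        have e1 : 1 / r * r = 1 := by field_simp
        have e2 : 1 / r.conjExponent * r = q := by
          rw [Real.conjExponent, ← hqdef]; field_simp
        rw [e1, e2, ENNReal.rpow_one]
  have hdoub : ∀ c s, 0 < s → μw (Metric.ball c (5*s)) * μσ (Metric.ball c (5*s)) ^ q ≤
      D * (μw (Metric.ball c s) * μσ (Metric.ball c s) ^ q) := by
    intro c s hs
    refine (hA' c (5*s) (by positivity)).trans ?_
    refine le_trans (le_of_eq ?_) (mul_le_mul_right (hol c s) D)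
    rw [vol_ball c s hs, hDdef, mul_pow, ENNReal.ofReal_mul (by positivity),
      ENNReal.mul_rpow_of_nonneg _ _ hr0.le, ENNReal.mul_rpow_of_nonneg _ _ hr0.le]
    have : cB⁻¹ ^ r * cB ^ r = 1 := by
      rw [← ENNReal.mul_rpow_of_nonneg _ _ hr0.le, ENNReal.inv_mul_cancel hcB0 hcBt, ENNReal.one_rpow]
    calc _ = K * (ENNReal.ofReal (5 ^ n) ^ r * ENNReal.ofReal (s ^ n) ^ r) * 1 := by rw [mul_one]
      _ = _ := by rw [← this]; ring
  have hsub5 : ∀ (c : Eucl n) (s : ℝ), 0 < s → Metric.ball c s ⊆ Metric.ball c (5*s) := fun c s hs =>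
    Metric.ball_subset_ball (by linarith)
  have dw : ∀ c s, 0 < s → μw (Metric.ball c (5*s)) ≤ D * μw (Metric.ball c s) := by
    intro c s hs
    have h5 : 0 < 5 * s := by positivity
    have hz : μσ (Metric.ball c (5*s)) ^ q ≠ 0 := by
      rw [Ne, ENNReal.rpow_eq_zero_iff_of_pos hq]; exact σ0 _ _ h5
    have ht : μσ (Metric.ball c (5*s)) ^ q ≠ ⊤ := ENNReal.rpow_ne_top_of_nonneg hq.le (σt _ _)
    refine (ENNReal.mul_le_mul_iff_left hz ht).1 ((hdoub c s hs).trans ?_)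
    rw [← mul_assoc]
    refine mul_le_mul_right (ENNReal.rpow_le_rpow (measure_mono (hsub5 c s hs)) hq.le) _
  have dσ : ∀ c s, 0 < s → μσ (Metric.ball c (5*s)) ≤ D ^ (1/q) * μσ (Metric.ball c s) := by
    intro c s hs
    have h5 : 0 < 5 * s := by positivity
    have h1 : μσ (Metric.ball c (5*s)) ^ q ≤ D * μσ (Metric.ball c s) ^ q := by
      refine (ENNReal.mul_le_mul_iff_right (w0 c _ h5) (wt c (5*s))).1 ((hdoub c s hs).trans ?_)
      calc _ ≤ D * (μw (Metric.ball c (5*s)) * μσ (Metric.ball c s) ^ q) :=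
            mul_le_mul_right (mul_le_mul_left (measure_mono (hsub5 c s hs)) _) _
        _ = _ := by ring
    have h2 := ENNReal.rpow_le_rpow h1 (z := 1/q) (by positivity)
    rw [ENNReal.mul_rpow_of_nonneg _ _ (by positivity), ← ENNReal.rpow_mul, ← ENNReal.rpow_mul,
      mul_one_div_cancel hq.ne', ENNReal.rpow_one, ENNReal.rpow_one] at h2
    exact h2
  set h : Eucl n → ℝ≥0∞ := fun y => f y * (σ y)⁻¹ with hh
  have hhm : Measurable h := by fun_prop
  set k : Eucl n → ℝ≥0∞ := fun y => MM μσ h y ^ q * (w y)⁻¹ with hk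
  have hMσ := MM_meas μσ h
  have hkm : Measurable k := by fun_prop
  have hpt : ∀ x, HLM f x ^ q ≤ (K * cB⁻¹) * MM μw k x := by
    intro x
    rw [← ENNReal.le_rpow_inv_iff hq]
    refine iSup₂_le fun s hs => ?_
    rw [ENNReal.le_rpow_inv_iff hq]
    set S := ENNReal.ofReal (s^n) with hS
    have hS0 : S ≠ 0 := by simp [hS, pow_pos hs n]
    have hSt : S ≠ ⊤ := by simp [hS]
    set I := ∫⁻ y in Metric.ball x s, f y with hI
    set Z := μσ (Metric.ball x s) with hZ
    set W := μw (Metric.ball x s) with hW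
    have hZ0 : Z ≠ 0 := σ0 x s hs
    have hZt : Z ≠ ⊤ := σt x s
    have hW0 : W ≠ 0 := w0 x s hs
    have hWt : W ≠ ⊤ := wt x s
    have hI' : ∫⁻ y in Metric.ball x s, h y ∂μσ = I := by
      rw [hμσ, setLIntegral_withDensity_eq_setLIntegral_mul _ hσ hhm measurableSet_ball]
      refine lintegral_congr_ae (ae_restrict_of_ae ?_)
      filter_upwards [hσae] with y hy
      simp only [Pi.mul_apply, hh]
      rw [mul_comm, mul_assoc, ENNReal.inv_mul_cancel hy.1 hy.2, mul_one]
    set m := Z⁻¹ * I with hm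
    have hIm : I = Z * m := by
      rw [hm, ← mul_assoc, ENNReal.mul_inv_cancel hZ0 hZt, one_mul]
    set J := ∫⁻ y in Metric.ball x s, k y ∂μw with hJ
    have hJ' : J = ∫⁻ y in Metric.ball x s, MM μσ h y ^ q := by
      rw [hJ, hμw, setLIntegral_withDensity_eq_setLIntegral_mul _ hw hkm measurableSet_ball]
      refine lintegral_congr_ae (ae_restrict_of_ae ?_)
      filter_upwards [hae] with y hy
      simp only [Pi.mul_apply, hk]
      rw [mul_comm, mul_assoc, ENNReal.inv_mul_cancel hy.1 hy.2, mul_one]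
    have hJm : S * cB * m ^ q ≤ J := by
      rw [hJ', ← vol_ball x s hs, mul_comm, ← setLIntegral_const]
      refine setLIntegral_mono' measurableSet_ball fun y hy => ?_
      refine ENNReal.rpow_le_rpow ?_ hq.le
      have := le_MM μσ h y x s hs hy
      rwa [hI'] at this
    have hT : Z ^ q ≤ W⁻¹ * (K * S ^ r) := by
      have := hA' x s hs
      rw [← ENNReal.div_eq_inv_mul, ENNReal.le_div_iff_mul_le (Or.inl hW0) (Or.inl hWt), mul_comm]
      exact this
    have hSr : S ^ r = S ^ q * S := by
      conv_rhs => rw [← ENNReal.rpow_one S, ← ENNReal.rpow_mul, one_mul, ← ENNReal.rpow_add _ _ hS0 hSt]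
      rw [hqdef]; congr 1; ring
    have hSq0 : S ^ q ≠ 0 := by rw [Ne, ENNReal.rpow_eq_zero_iff_of_pos hq]; exact hS0
    have hSqt : S ^ q ≠ ⊤ := ENNReal.rpow_ne_top_of_nonneg hq.le hSt
    calc (S⁻¹ * I) ^ q = (S ^ q)⁻¹ * Z ^ q * m ^ q := by
          rw [hIm, ENNReal.mul_rpow_of_nonneg _ _ hq.le, ENNReal.mul_rpow_of_nonneg _ _ hq.le,
            ENNReal.inv_rpow, mul_assoc]
      _ ≤ (S ^ q)⁻¹ * (W⁻¹ * (K * S ^ r)) * m ^ q := by gcongr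
      _ = ((S ^ q)⁻¹ * S ^ q) * (cB⁻¹ * cB) * (K * W⁻¹ * (S * m ^ q)) := by
          rw [ENNReal.inv_mul_cancel hSq0 hSqt, ENNReal.inv_mul_cancel hcB0 hcBt, hSr]
          calc _ = ((S ^ q)⁻¹ * S ^ q) * (K * W⁻¹ * (S * m ^ q)) := by ring
            _ = _ := by rw [ENNReal.inv_mul_cancel hSq0 hSqt]; ring
      _ = (K * cB⁻¹) * (W⁻¹ * (S * cB * m ^ q)) := by
          rw [ENNReal.inv_mul_cancel hSq0 hSqt]; ring
      _ ≤ (K * cB⁻¹) * (W⁻¹ * J) := by gcongr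
      _ ≤ (K * cB⁻¹) * MM μw k x := by
          gcongr
          exact le_MM μw k x x s hs (Metric.mem_ball_self hs)
  have hSF1 : SFinite μw := by rw [hμw]; infer_instance
  have hSF2 : SFinite μσ := by rw [hμσ]; infer_instance
  have hHm := HLM_meas f
  have hMw := MM_meas μw k
  calc ∫⁻ x, HLM f x ^ r * w x = ∫⁻ x, HLM f x ^ r ∂μw := by
        rw [hμw, lintegral_withDensity_eq_lintegral_mul _ hw (by fun_prop)]
        refine lintegral_congr fun x => ?_
        simp [mul_comm]
    _ ≤ ∫⁻ x, (K * cB⁻¹) ^ (r/q) * MM μw k x ^ (r/q) ∂μw := by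
        refine lintegral_mono fun x => ?_
        have h1 := ENNReal.rpow_le_rpow (hpt x) (z := r/q) (by positivity)
        rw [← ENNReal.rpow_mul, mul_div_cancel₀ _ hq.ne', ENNReal.mul_rpow_of_nonneg _ _ (by positivity)] at h1
        exact h1
    _ = (K * cB⁻¹) ^ (r/q) * ∫⁻ x, MM μw k x ^ (r/q) ∂μw := by
        rw [lintegral_const_mul _ (by fun_prop)]
    _ ≤ (K * cB⁻¹) ^ (r/q) * (C1 * ∫⁻ x, k x ^ (r/q) ∂μw) := by
        exact mul_le_mul_right (H1 μw hSF1 w0 wt dw k hkm) _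
    _ = (K * cB⁻¹) ^ (r/q) * (C1 * ∫⁻ x, MM μσ h x ^ r ∂μσ) := by
        congr 2
        rw [hμw, lintegral_withDensity_eq_lintegral_mul _ hw (by fun_prop)]
        conv_rhs => rw [hμσ]
        rw [lintegral_withDensity_eq_lintegral_mul _ hσ (by fun_prop)]
        refine lintegral_congr_ae ?_
        filter_upwards [hae] with y hy
        simp only [Pi.mul_apply, hk, hσdef]
        rw [ENNReal.mul_rpow_of_nonneg _ _ (by positivity), ← ENNReal.rpow_mul,
          mul_div_cancel₀ _ hq.ne', mul_comm, mul_assoc, mul_comm]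
        congr 1
        rw [← ENNReal.rpow_neg_one, ← ENNReal.rpow_mul]
        conv_lhs => rw [← ENNReal.rpow_one (w y), ← ENNReal.rpow_mul, one_mul, ← ENNReal.rpow_add _ _ hy.1 hy.2]
        congr 1
        field_simp; rw [hqdef]; ring
    _ ≤ (K * cB⁻¹) ^ (r/q) * (C1 * (C2 * ∫⁻ x, h x ^ r ∂μσ)) := by
        exact mul_le_mul_right (mul_le_mul_right (H2 μσ hSF2 σ0 σt dσ h hhm) _) _
    _ = (K * cB⁻¹) ^ (r/q) * (C1 * (C2 * ∫⁻ x, f x ^ r * w x)) := by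
        congr 3
        rw [hμσ, lintegral_withDensity_eq_lintegral_mul _ hσ (by fun_prop)]
        refine lintegral_congr_ae ?_
        filter_upwards [hae] with y hy
        simp only [Pi.mul_apply, hh, hσdef]
        rw [ENNReal.mul_rpow_of_nonneg _ _ hr0.le, mul_comm, mul_assoc]
        congr 1
        rw [← ENNReal.rpow_neg_one, ← ENNReal.rpow_mul, ← ENNReal.rpow_mul, ← ENNReal.rpow_add _ _ hy.1 hy.2]
        conv_rhs => rw [← ENNReal.rpow_one (w y)]
        congr 1
        field_simp; rw [hqdef]; ring
    _ = _ := by ring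

lemma ae_fin {n : ℕ} (u : Eucl n → ℝ≥0∞) (hu : Measurable u)
    (h : ∀ c s, 0 < s → ∫⁻ y in Metric.ball c s, u y ≠ ⊤) : ∀ᵐ x, u x ≠ ⊤ := by
  have h3 : ∀ k : ℕ, ∀ᵐ y ∂volume, y ∈ Metric.ball (0 : Eucl n) ((k:ℝ)+1) → u y ≠ ⊤ := by
    intro k
    have := ae_lt_top hu (h 0 ((k:ℝ)+1) (by positivity))
    rw [ae_restrict_iff' measurableSet_ball] at this
    filter_upwards [this] with y hy hy' using (hy hy').ne
  filter_upwards [ae_all_iff.2 h3] with y hy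
  obtain ⟨k, hk⟩ := exists_nat_gt (dist y 0)
  exact hy k (by rw [Metric.mem_ball]; linarith)

lemma A1_ball {n : ℕ} (A : ℝ≥0∞) (u : Eucl n → ℝ≥0∞)
    (hA : ∀ x, HLM u x ≤ A * u x) (c y : Eucl n) (s : ℝ) (hs : 0 < s) (hy : y ∈ Metric.ball c s) :
    ∫⁻ z in Metric.ball c s, u z ≤ (A * ENNReal.ofReal ((2*s)^n)) * u y := by
  have h2 : 0 < 2 * s := by positivity
  have hS0 : ENNReal.ofReal ((2*s)^n) ≠ 0 := by simp [pow_pos h2 n]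
  have h1 := (le_iSup₂ (f := fun (r : ℝ) (_ : 0 < r) =>
    (ENNReal.ofReal (r ^ n))⁻¹ * ∫⁻ z in Metric.ball y r, u z) (2*s) h2).trans (hA y)
  rw [← ENNReal.div_eq_inv_mul, ENNReal.div_le_iff hS0 (by simp)] at h1
  calc _ ≤ ∫⁻ z in Metric.ball y (2*s), u z := by
        refine lintegral_mono_set (Metric.ball_subset_ball' ?_)
        rw [Metric.mem_ball, dist_comm] at hy; linarith
    _ ≤ _ := h1
    _ = _ := by ring

lemma Ar_of_A1 {n : ℕ} (r : ℝ) (hr : 1 < r) (A : ℝ≥0∞) (hA0 : A ≠ 0) (hAt : A ≠ ⊤)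
    (u v : Eucl n → ℝ≥0∞) (hu : Measurable u) (hv : Measurable v)
    (u0 : ∀ x, 0 < u x) (v0 : ∀ x, 0 < v x)
    (ut : ∀ c s, 0 < s → ∫⁻ y in Metric.ball c s, u y ≠ ⊤)
    (vt : ∀ c s, 0 < s → ∫⁻ y in Metric.ball c s, v y ≠ ⊤)
    (hMu : ∀ x, HLM u x ≤ A * u x) (hMv : ∀ x, HLM v x ≤ A * v x) :
    (∀ᵐ x, u x ^ (-(r-1)) * v x ≠ 0 ∧ u x ^ (-(r-1)) * v x ≠ ⊤) ∧
      ∀ c s, 0 < s → (∫⁻ y in Metric.ball c s, u y ^ (-(r-1)) * v y) *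
        (∫⁻ y in Metric.ball c s, (u y ^ (-(r-1)) * v y) ^ (-(1/(r-1)))) ^ (r-1) ≤
          (A * ENNReal.ofReal (2^n)) ^ r * ENNReal.ofReal (s^n) ^ r := by
  have hq : 0 < r - 1 := by linarith
  have hr0 : 0 < r := by linarith
  have uae := ae_fin u hu ut
  have vae := ae_fin v hv vt
  constructor
  · filter_upwards [uae, vae] with x hx hx'
    exact ⟨mul_ne_zero (ENNReal.rpow_pos (u0 x) hx).ne' (v0 x).ne',
      ENNReal.mul_ne_top (ENNReal.rpow_ne_top_of_ne_zero (u0 x).ne' hx) hx'⟩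
  intro c s hs
  set q := r - 1 with hqdef
  set Q := A * ENNReal.ofReal ((2*s)^n) with hQ
  have hQ0 : Q ≠ 0 := by
    have h2 : 0 < 2 * s := by positivity
    exact mul_ne_zero hA0 (by simp [pow_pos h2 n])
  have hQt : Q ≠ ⊤ := ENNReal.mul_ne_top hAt (by simp)
  set U := ∫⁻ y in Metric.ball c s, u y with hU
  set V := ∫⁻ y in Metric.ball c s, v y with hV
  have hU0 : U ≠ 0 := int_ball_ne_zero u hu (ae_of_all _ fun x => (u0 x).ne') c s hs
  have hV0 : V ≠ 0 := int_ball_ne_zero v hv (ae_of_all _ fun x => (v0 x).ne') c s hs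
  have hUt : U ≠ ⊤ := ut c s hs
  have hVt : V ≠ ⊤ := vt c s hs
  have hUq0 : U ^ q ≠ 0 := by rw [Ne, ENNReal.rpow_eq_zero_iff_of_pos hq]; exact hU0
  have hUqt : U ^ q ≠ ⊤ := ENNReal.rpow_ne_top_of_nonneg hq.le hUt
  have b1 : ∫⁻ y in Metric.ball c s, u y ^ (-q) * v y ≤ ((U/Q) ^ q)⁻¹ * V := by
    rw [← lintegral_const_mul _ hv]
    refine setLIntegral_mono' measurableSet_ball fun y hy => ?_
    rw [ENNReal.rpow_neg]
    gcongr
    rw [ENNReal.div_le_iff hQ0 hQt, mul_comm]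
    exact A1_ball A u hMu c y s hs hy
  have b2 : ∫⁻ y in Metric.ball c s, (u y ^ (-q) * v y) ^ (-(1/q)) ≤ ((V/Q) ^ (1/q))⁻¹ * U := by
    rw [← lintegral_const_mul _ hu]
    refine setLIntegral_mono_ae' measurableSet_ball ?_
    filter_upwards [uae, vae] with y hy1 hy2 hy
    rw [ENNReal.mul_rpow_of_ne_top (ENNReal.rpow_ne_top_of_ne_zero (u0 y).ne' hy1) hy2,
      ← ENNReal.rpow_mul, show -q * -(1/q) = 1 by field_simp, ENNReal.rpow_one, mul_comm,
      ENNReal.rpow_neg]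
    gcongr
    rw [ENNReal.div_le_iff hQ0 hQt, mul_comm]
    exact A1_ball A v hMv c y s hs hy
  have hQr : Q ^ r = Q ^ q * Q := by
    conv_rhs => rw [← ENNReal.rpow_one Q, ← ENNReal.rpow_mul, one_mul, ← ENNReal.rpow_add _ _ hQ0 hQt]
    rw [hqdef]; congr 1; ring
  calc _ ≤ (((U/Q) ^ q)⁻¹ * V) * (((V/Q) ^ (1/q))⁻¹ * U) ^ q := by gcongr
    _ = (Q ^ q * (U ^ q)⁻¹ * V) * ((Q * V⁻¹) * U ^ q) := by
        rw [ENNReal.mul_rpow_of_nonneg _ _ hq.le]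
        congr 2
        · rw [← ENNReal.inv_rpow, ENNReal.inv_div (Or.inl hQt) (Or.inl hQ0), div_eq_mul_inv,
            ENNReal.mul_rpow_of_nonneg _ _ hq.le, ENNReal.inv_rpow]
        · rw [ENNReal.inv_rpow, ← ENNReal.rpow_mul, one_div_mul_cancel hq.ne', ENNReal.rpow_one,
            ENNReal.inv_div (Or.inl hQt) (Or.inl hQ0), div_eq_mul_inv]
    _ = (Q ^ q * Q) * ((U ^ q)⁻¹ * U ^ q) * (V⁻¹ * V) := by ring
    _ = Q ^ r := by
        rw [ENNReal.inv_mul_cancel hUq0 hUqt, ENNReal.inv_mul_cancel hV0 hVt, hQr]; simp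
    _ = _ := by
        rw [hQ, mul_pow, ENNReal.ofReal_mul (by positivity), ← mul_assoc, ENNReal.mul_rpow_of_nonneg _ _ hr0.le]

/-- Truncation in height and support. -/
def trunc {n : ℕ} (N : ℕ) (f : Eucl n → ℝ≥0∞) : Eucl n → ℝ≥0∞ :=
  (Metric.ball (0 : Eucl n) N).indicator (fun x => min (f x) N)

lemma trunc_meas {n : ℕ} (N : ℕ) (f : Eucl n → ℝ≥0∞) (hf : Measurable f) :
    Measurable (trunc N f) :=
  (hf.min measurable_const).indicator measurableSet_ball

lemma trunc_le {n : ℕ} (N : ℕ) (f : Eucl n → ℝ≥0∞) (x : Eucl n) : trunc N f x ≤ f x := by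
  unfold trunc
  by_cases h : x ∈ Metric.ball (0 : Eucl n) N <;> simp [Set.indicator, h]

lemma trunc_ne_top {n : ℕ} (N : ℕ) (f : Eucl n → ℝ≥0∞) (x : Eucl n) : trunc N f x ≠ ⊤ := by
  unfold trunc
  by_cases h : x ∈ Metric.ball (0 : Eucl n) N <;> simp [Set.indicator, h]

lemma trunc_mono {n : ℕ} (f : Eucl n → ℝ≥0∞) : Monotone (fun N => trunc N f) := by
  intro N M h x
  have h' : (N : ℝ) ≤ M := by exact_mod_cast h
  have h'' : (N : ℝ≥0∞) ≤ M := by exact_mod_cast h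
  simp only [trunc]
  by_cases hx : x ∈ Metric.ball (0 : Eucl n) N
  · rw [Set.indicator_of_mem hx, Set.indicator_of_mem (Metric.ball_subset_ball h' hx)]
    exact min_le_min le_rfl h''
  · rw [Set.indicator_of_notMem hx]
    exact bot_le

lemma trunc_tendsto {n : ℕ} (f : Eucl n → ℝ≥0∞) (x : Eucl n) :
    Tendsto (fun N => trunc N f x) atTop (𝓝 (f x)) := by
  have h1 : Tendsto (fun N : ℕ => min (f x) (N : ℝ≥0∞)) atTop (𝓝 (f x)) := by
    simpa using (tendsto_const_nhds (x := f x)).min ENNReal.tendsto_nat_nhds_top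
  refine h1.congr' ?_
  obtain ⟨k, hk⟩ := exists_nat_gt (dist x 0)
  filter_upwards [eventually_ge_atTop k] with N hN
  have : x ∈ Metric.ball (0 : Eucl n) N := by
    rw [Metric.mem_ball]
    have : (k : ℝ) ≤ N := by exact_mod_cast hN
    linarith
  simp [trunc, Set.indicator_of_mem this]

lemma trunc_memLp {n : ℕ} (N : ℕ) (f : Eucl n → ℝ≥0∞) (e : Eucl n → ℝ)
    (he : Measurable e) (hle : ∀ x, |e x| ≤ (trunc N f x).toReal) :
    MemLp e 2 (volume : Measure (Eucl n)) := by
  have h1 : MemLp ((Metric.ball (0 : Eucl n) N).indicator fun _ => (N : ℝ)) 2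
      (volume : Measure (Eucl n)) :=
    memLp_indicator_const 2 measurableSet_ball (N : ℝ) (Or.inr measure_ball_lt_top.ne)
  refine h1.mono he.aestronglyMeasurable (ae_of_all _ fun x => ?_)
  rw [Real.norm_eq_abs]
  refine (hle x).trans ?_
  by_cases h : x ∈ Metric.ball (0 : Eucl n) N
  · simp only [trunc, Set.indicator_of_mem h]
    simp only [Real.norm_natCast]
    refine ENNReal.toReal_le_of_le_ofReal (by positivity) ?_
    simp
  · simp [trunc, Set.indicator_of_notMem h]

lemma lux {n : ℕ} (ρ : (Eucl n → ℝ≥0∞) → ℝ≥0∞) (hρ : IsBBFN n ρ)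
    (F : Eucl n → ℝ≥0∞) (hF : Measurable F) (h1 : 1 < ρ F) :
    ∃ (h : Eucl n → ℝ≥0∞) (s : ℝ≥0∞), Measurable h ∧ kdual n ρ h ≤ s ∧ s < ∫⁻ x, F x * h x := by
  let E := Lp ℝ 2 (volume : Measure (Eucl n))
  have hmeas : ∀ f : E, Measurable fun x => ‖f x‖ₑ := fun f =>
    (Lp.stronglyMeasurable f).measurable.enorm
  let K : Set E := {f | ρ (fun x => ‖f x‖ₑ) ≤ 1}
  have hKc : Convex ℝ K := by
    intro f hf g hg a b ha hb hab
    have hf' : ρ (fun x => ‖f x‖ₑ) ≤ 1 := hf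
    have hg' : ρ (fun x => ‖g x‖ₑ) ≤ 1 := hg
    change ρ (fun x => ‖(a • f + b • g : E) x‖ₑ) ≤ 1
    let a' : ℝ≥0 := ⟨a, ha⟩
    let b' : ℝ≥0 := ⟨b, hb⟩
    have hab' : (a' : ℝ≥0∞) + b' = 1 := by
      rw [← ENNReal.coe_add, ← ENNReal.coe_one]; congr 1; exact NNReal.eq hab
    have hea : ‖a‖ₑ = a' := by rw [Real.enorm_eq_ofReal ha]; exact ENNReal.ofReal_eq_coe_nnreal ha
    have heb : ‖b‖ₑ = b' := by rw [Real.enorm_eq_ofReal hb]; exact ENNReal.ofReal_eq_coe_nnreal hb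
    calc _ ≤ ρ (fun x => (a' : ℝ≥0∞) * ‖f x‖ₑ + (b' : ℝ≥0∞) * ‖g x‖ₑ) := by
          refine hρ.mono _ _ (hmeas _) (((hmeas f).const_mul _).add ((hmeas g).const_mul _)) ?_
          filter_upwards [Lp.coeFn_add (a • f) (b • g), Lp.coeFn_smul a f, Lp.coeFn_smul b g]
            with x h1 h2 h3
          rw [h1, Pi.add_apply, h2, h3, Pi.smul_apply, Pi.smul_apply]
          refine (enorm_add_le _ _).trans ?_
          rw [smul_eq_mul, smul_eq_mul, enorm_mul, enorm_mul, hea, heb]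
      _ ≤ ρ (fun x => (a' : ℝ≥0∞) * ‖f x‖ₑ) + ρ (fun x => (b' : ℝ≥0∞) * ‖g x‖ₑ) :=
          hρ.add_le _ _ ((hmeas f).const_mul _) ((hmeas g).const_mul _)
      _ = a' * ρ (fun x => ‖f x‖ₑ) + b' * ρ (fun x => ‖g x‖ₑ) := by
          rw [hρ.smul _ _ (hmeas f), hρ.smul _ _ (hmeas g)]
      _ ≤ a' * 1 + b' * 1 := by gcongr
      _ = 1 := by rw [mul_one, mul_one, hab']
  have hKcl : IsClosed K := by
    refine IsSeqClosed.isClosed ?_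
    intro fs f hfs hlim
    obtain ⟨ns, -, hns⟩ := (tendstoInMeasure_of_tendsto_Lp hlim).exists_seq_tendsto_ae
    let g : ℕ → Eucl n → ℝ≥0∞ := fun k x => ⨅ i, ‖fs (ns (i + k)) x‖ₑ
    have hg : ∀ k, Measurable (g k) := fun k => Measurable.iInf fun i => hmeas _
    have hgm : ∀ x, Monotone fun k => g k x := by
      intro x k l hkl
      refine le_iInf fun i => ?_
      refine iInf_le_of_le (i + (l - k)) ?_
      rw [show i + (l - k) + k = i + l by omega]
    have ht := hρ.fatou g (fun x => ‖f x‖ₑ) hg (hmeas f) (ae_of_all _ hgm) ?_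
    · refine le_of_tendsto' ht fun k => ?_
      refine le_trans (hρ.mono _ _ (hg k) (hmeas (fs (ns (0 + k)))) (ae_of_all _ fun x => iInf_le _ 0)) ?_
      exact hfs _
    · filter_upwards [hns] with x hx
      have h2 : Tendsto (fun i => ‖fs (ns i) x‖ₑ) atTop (𝓝 ‖f x‖ₑ) := hx.enorm
      have h3 := tendsto_atTop_iSup (hgm x)
      have h4 : ⨆ k, g k x = ‖f x‖ₑ := by
        rw [← h2.liminf_eq, liminf_eq_iSup_iInf_of_nat']
      rwa [h4] at h3
  have h0K : (0 : E) ∈ K := by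
    change ρ (fun x => ‖(0 : E) x‖ₑ) ≤ 1
    have : ρ (fun x => ‖(0 : E) x‖ₑ) = 0 := by
      rw [hρ.zero_iff _ (hmeas 0)]
      filter_upwards [Lp.coeFn_zero ℝ 2 (volume : Measure (Eucl n))] with x hx
      simp [E]
    rw [this]; exact zero_le_one
  -- truncation of F outside K
  obtain ⟨N, hN⟩ : ∃ N, 1 < ρ (trunc N F) := by
    have := hρ.fatou (fun N => trunc N F) F (fun N => trunc_meas N F hF) hF
      (ae_of_all _ fun x i j hij => trunc_mono F hij x) (ae_of_all _ (trunc_tendsto F))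
    exact ((this.eventually (lt_mem_nhds h1))).exists
  have hFN : MemLp (fun x => (trunc N F x).toReal) 2 (volume : Measure (Eucl n)) :=
    trunc_memLp N F _ (trunc_meas N F hF).ennreal_toReal (fun x => by simp)
  let Φ : E := hFN.toLp _
  have hΦ : Φ ∉ K := by
    intro hc
    have hc' : ρ (fun x => ‖Φ x‖ₑ) ≤ 1 := hc
    rw [hρ.ae_congr _ (trunc N F)] at hc'
    · exact absurd hN (not_lt.2 hc')
    · filter_upwards [hFN.coeFn_toLp] with x hx
      simp only [Φ, hx]
      rw [Real.enorm_eq_ofReal ENNReal.toReal_nonneg, ENNReal.ofReal_toReal (trunc_ne_top N F x)]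
  obtain ⟨φ, b, hb1, hb2⟩ := geometric_hahn_banach_closed_point hKc hKcl hΦ
  have hb0 : 0 < b := by simpa using hb1 0 h0K
  let h : E := (InnerProductSpace.toDual ℝ E).symm φ
  have hφ : ∀ a : E, φ a = ∫ x, a x * h x := by
    intro a
    have : φ a = inner ℝ h a := by simp [h]
    rw [this, L2.inner_def]
    rfl
  refine ⟨fun x => ‖h x‖ₑ, ENNReal.ofReal b, hmeas h, ?_, ?_⟩
  · refine iSup₂_le fun f hf => ?_
    obtain ⟨hfm, hf1⟩ := hf
    have hlim : Tendsto (fun M => ∫⁻ x, trunc M f x * ‖h x‖ₑ) atTop (𝓝 (∫⁻ x, f x * ‖h x‖ₑ)) := by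
      refine lintegral_tendsto_of_tendsto_of_monotone
        (fun M => ((trunc_meas M f hfm).mul (hmeas h)).aemeasurable) (ae_of_all _ ?_) (ae_of_all _ ?_)
      · intro x i j hij
        exact mul_le_mul_left (trunc_mono f hij x) _
      · intro x
        exact ENNReal.Tendsto.mul_const (trunc_tendsto f x) (Or.inr (by simp))
    refine le_of_tendsto' hlim fun M => ?_
    let e : Eucl n → ℝ := fun x => (if 0 ≤ h x then 1 else -1) * (trunc M f x).toReal
    have he : Measurable e := by
      refine Measurable.mul ?_ (trunc_meas M f hfm).ennreal_toReal
      exact Measurable.ite (measurableSet_le measurable_const (Lp.stronglyMeasurable h).measurable)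
        measurable_const measurable_const
    have habs : ∀ x, |e x| = (trunc M f x).toReal := by
      intro x
      simp only [e]
      split_ifs <;> simp
    have heL : MemLp e 2 (volume : Measure (Eucl n)) := trunc_memLp M f e he (fun x => (habs x).le)
    have hen : ∀ x, ‖e x‖ₑ = trunc M f x := by
      intro x
      rw [Real.enorm_eq_ofReal_abs, habs,
        ENNReal.ofReal_toReal (trunc_ne_top M f x)]
    let a : E := heL.toLp _
    have haK : a ∈ K := by
      change ρ (fun x => ‖a x‖ₑ) ≤ 1
      rw [hρ.ae_congr _ (trunc M f)]
      · exact (hρ.mono _ _ (trunc_meas M f hfm) hfm (ae_of_all _ (trunc_le M f))).trans hf1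
      · filter_upwards [heL.coeFn_toLp] with x hx
        simp only [a, hx, hen]
    have h5 := (hb1 a haK).le
    rw [hφ] at h5
    have h6 : ∫ x, a x * h x = ∫ x, e x * h x := by
      refine integral_congr_ae ?_
      filter_upwards [heL.coeFn_toLp] with x hx
      simp only [a, hx]
    have hnn : ∀ x, 0 ≤ e x * h x := by
      intro x
      simp only [e]
      have := ENNReal.toReal_nonneg (a := trunc M f x)
      split_ifs with hh
      · rw [one_mul]; exact mul_nonneg this hh
      · nlinarith [not_le.1 hh]
    have hInteg : Integrable (fun x => e x * h x) (volume : Measure (Eucl n)) :=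
      heL.integrable_mul (Lp.memLp h)
    rw [h6] at h5
    have h7 := ENNReal.ofReal_le_ofReal h5
    rw [ofReal_integral_eq_lintegral_ofReal hInteg (ae_of_all _ hnn)] at h7
    refine le_trans (le_of_eq ?_) h7
    refine lintegral_congr fun x => ?_
    rw [← Real.enorm_eq_ofReal (hnn x), enorm_mul, hen]
  · rw [hφ] at hb2
    have h6 : ∫ x, Φ x * h x = ∫ x, (trunc N F x).toReal * h x := by
      refine integral_congr_ae ?_
      filter_upwards [hFN.coeFn_toLp] with x hx
      simp only [Φ, hx]
    rw [h6] at hb2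
    calc ENNReal.ofReal b < ENNReal.ofReal (∫ x, (trunc N F x).toReal * h x) :=
          (ENNReal.ofReal_lt_ofReal_iff_of_nonneg hb0.le).2 hb2
      _ = ‖∫ x, (trunc N F x).toReal * h x‖ₑ := (Real.enorm_eq_ofReal (hb0.trans hb2).le).symm
      _ ≤ ∫⁻ x, ‖(trunc N F x).toReal * h x‖ₑ := enorm_integral_le_lintegral_enorm _
      _ ≤ ∫⁻ x, F x * ‖h x‖ₑ := by
          refine lintegral_mono fun x => ?_
          rw [enorm_mul, Real.enorm_eq_ofReal ENNReal.toReal_nonneg,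
            ENNReal.ofReal_toReal (trunc_ne_top N F x)]
          exact mul_le_mul_left (trunc_le N F x) _

lemma kdual_tsum {n : ℕ} (ρ : (Eucl n → ℝ≥0∞) → ℝ≥0∞) (g : ℕ → Eucl n → ℝ≥0∞)
    (hg : ∀ k, Measurable (g k)) :
    kdual n ρ (fun x => ∑' k, g k x) ≤ ∑' k, kdual n ρ (g k) := by
  refine iSup₂_le fun f hf => ?_
  simp_rw [← ENNReal.tsum_mul_left]
  rw [lintegral_tsum (f := fun k x => f x * g k x) fun k => (hf.1.mul (hg k)).aemeasurable]
  refine ENNReal.tsum_le_tsum fun k => ?_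
  exact le_iSup₂ (f := fun (f : Eucl n → ℝ≥0∞) (_ : Measurable f ∧ ρ f ≤ 1) => ∫⁻ x, f x * g k x) f hf

lemma kdual_smul {n : ℕ} (ρ : (Eucl n → ℝ≥0∞) → ℝ≥0∞) (a : ℝ≥0) (g : Eucl n → ℝ≥0∞)
    (hg : Measurable g) :
    kdual n ρ (fun x => (a : ℝ≥0∞) * g x) = a * kdual n ρ g := by
  simp only [kdual, ENNReal.mul_iSup]
  refine iSup_congr fun f => iSup_congr fun hf => ?_
  rw [← lintegral_const_mul (f := fun x => f x * g x) _ (hf.1.mul hg)]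
  refine lintegral_congr fun x => ?_
  ring

lemma rho_tsum {n : ℕ} (ρ : (Eucl n → ℝ≥0∞) → ℝ≥0∞) (hρ : IsBBFN n ρ) (g : ℕ → Eucl n → ℝ≥0∞)
    (hg : ∀ k, Measurable (g k)) :
    ρ (fun x => ∑' k, g k x) ≤ ∑' k, ρ (g k) := by
  have hm : ∀ N, Measurable fun x => ∑ k ∈ Finset.range N, g k x := fun N =>
    Finset.measurable_fun_sum _ fun k _ => hg k
  have ht := hρ.fatou (fun N x => ∑ k ∈ Finset.range N, g k x) (fun x => ∑' k, g k x) hm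
    (Measurable.tsum hg)
    (ae_of_all _ fun x i j hij => Finset.sum_le_sum_of_subset (Finset.range_mono hij))
    (ae_of_all _ fun x => ENNReal.tendsto_nat_tsum _)
  refine le_of_tendsto' ht fun N => ?_
  refine le_trans ?_ (ENNReal.sum_le_tsum (Finset.range N))
  induction N with
  | zero =>
    have : ρ (fun x => ∑ k ∈ Finset.range 0, g k x) = 0 := by
      rw [hρ.zero_iff _ (hm 0)]
      simp; rfl
    simpa using this
  | succ N ih =>
    simp_rw [Finset.sum_range_succ]
    refine (hρ.add_le _ _ (hm N) (hg N)).trans ?_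
    gcongr

lemma holder_dual {n : ℕ} (ρ : (Eucl n → ℝ≥0∞) → ℝ≥0∞) (hρ : IsBBFN n ρ)
    (f g : Eucl n → ℝ≥0∞) (hf : Measurable f) (hg : Measurable g) (hft : ρ f ≠ ⊤) :
    ∫⁻ x, f x * g x ≤ ρ f * kdual n ρ g := by
  by_cases h0 : ρ f = 0
  · have := (hρ.zero_iff f hf).1 h0
    have h1 : ∫⁻ x, f x * g x = ∫⁻ _ : Eucl n, (0:ℝ≥0∞) := by
      refine lintegral_congr_ae ?_
      filter_upwards [this] with x hx
      simp [hx]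
    rw [h1]; simp
  · obtain ⟨t, ht⟩ : ∃ t : ℝ≥0, (t : ℝ≥0∞) = (ρ f)⁻¹ :=
      ⟨((ρ f)⁻¹).toNNReal, ENNReal.coe_toNNReal (by simpa using h0)⟩
    have h1 : ρ (fun x => (t : ℝ≥0∞) * f x) ≤ 1 := by
      rw [hρ.smul t f hf, ht, ENNReal.inv_mul_cancel h0 hft]
    have h2 := le_iSup₂ (f := fun (f : Eucl n → ℝ≥0∞) (_ : Measurable f ∧ ρ f ≤ 1) =>
      ∫⁻ x, f x * g x) (fun x => (t : ℝ≥0∞) * f x) ⟨hf.const_mul _, h1⟩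
    have h3 : ∫⁻ x, (t : ℝ≥0∞) * f x * g x = (ρ f)⁻¹ * ∫⁻ x, f x * g x := by
      rw [← ht, ← lintegral_const_mul (f := fun x => f x * g x) _ (hf.mul hg)]
      refine lintegral_congr fun x => ?_
      ring
    rw [h3] at h2
    calc ∫⁻ x, f x * g x = ρ f * ((ρ f)⁻¹ * ∫⁻ x, f x * g x) := by
          rw [← mul_assoc, ENNReal.mul_inv_cancel h0 hft, one_mul]
      _ ≤ _ := by gcongr; exact h2

lemma core_est (n : ℕ) (r : ℝ) (hr : 1 < r)
    (ρ : (Eucl n → ℝ≥0∞) → ℝ≥0∞) (hρ : IsBBFN n ρ)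
    (hM : MBddOn n ρ) (hM' : MBddOn n (kdual n ρ)) :
    ∃ B : ℝ≥0∞, B ≠ ⊤ ∧ ∀ f : ℕ → Eucl n → ℝ≥0∞, (∀ j, Measurable (f j)) →
      ρ (fun x => (∑' j : ℕ, f j x ^ r) ^ (1/r)) ≠ 0 →
      ρ (fun x => (∑' j : ℕ, f j x ^ r) ^ (1/r)) ≠ ⊤ →
      ∀ h : Eucl n → ℝ≥0∞, Measurable h → kdual n ρ h ≠ ⊤ →
      ∫⁻ x, (∑' j : ℕ, HLM (f j) x ^ r) ^ (1/r) * h x ≤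
        B * ρ (fun x => (∑' j : ℕ, f j x ^ r) ^ (1/r)) * kdual n ρ h := by
  obtain ⟨C1, hC1, H1⟩ := hM
  obtain ⟨C2, hC2, H2⟩ := hM'
  have hr0 : 0 < r := by linarith
  have hq : 0 < r - 1 := by linarith
  set A := ENNReal.ofReal (2 * C1) + ENNReal.ofReal (2 * C2) with hA
  have hA0 : A ≠ 0 := by
    have : ENNReal.ofReal (2 * C1) ≠ 0 := by simpa using hC1
    simp [hA, hC1]
  have hAt : A ≠ ⊤ := ENNReal.add_ne_top.2 ⟨ENNReal.ofReal_ne_top, ENNReal.ofReal_ne_top⟩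
  obtain ⟨C0, hC0, H0⟩ := muck n r hr ((A * ENNReal.ofReal (2^n)) ^ r)
    (ENNReal.rpow_ne_top_of_nonneg hr0.le (ENNReal.mul_ne_top hAt (by simp)))
  refine ⟨4 * C0 ^ (1/r), ENNReal.mul_ne_top (by simp)
    (ENNReal.rpow_ne_top_of_nonneg (by positivity) hC0), ?_⟩
  intro f hf hG0 hGt h hh hht
  set G : Eucl n → ℝ≥0∞ := fun x => (∑' j : ℕ, f j x ^ r) ^ (1/r) with hG
  set F : Eucl n → ℝ≥0∞ := fun x => (∑' j : ℕ, HLM (f j) x ^ r) ^ (1/r) with hFdef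
  have hGm : Measurable G := (Measurable.tsum fun j => (hf j).pow_const r).pow_const _
  have hFm : Measurable F := (Measurable.tsum fun j => (HLM_meas (f j)).pow_const r).pow_const _
  by_cases hh0 : h =ᵐ[volume] 0
  · have : ∫⁻ x, F x * h x = ∫⁻ _ : Eucl n, (0:ℝ≥0∞) := by
      refine lintegral_congr_ae ?_
      filter_upwards [hh0] with x hx
      simp [hx]
    change ∫⁻ x, F x * h x ≤ _
    rw [this]; simp
  have hG0' : ¬ G =ᵐ[volume] 0 := fun hc => hG0 ((hρ.zero_iff G hGm).2 hc)
  obtain ⟨u, hu, hGu, u0, hNu, hMu⟩ := rubio ρ (rho_tsum ρ hρ) hρ.smul C1 hC1 H1 G hGm hG0'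
  obtain ⟨v, hv, hhv, v0, hNv, hMv⟩ := rubio (kdual n ρ) (kdual_tsum ρ) (kdual_smul ρ) C2 hC2 H2 h hh hh0
  have hut : ρ u ≠ ⊤ := ne_top_of_le_ne_top (ENNReal.mul_ne_top (by simp) hGt) hNu
  have hvt : kdual n ρ v ≠ ⊤ := ne_top_of_le_ne_top (ENNReal.mul_ne_top (by simp) hht) hNv
  have ut : ∀ c s, 0 < s → ∫⁻ y in Metric.ball c s, u y ≠ ⊤ := by
    intro c s hs
    obtain ⟨C, _, hC⟩ := hρ.ball_lower c s hs
    exact ne_top_of_le_ne_top (ENNReal.mul_ne_top (by simp) hut) (hC u hu)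
  have vt : ∀ c s, 0 < s → ∫⁻ y in Metric.ball c s, v y ≠ ⊤ := by
    intro c s hs
    have hb := (hρ.ball_mem c s hs).ne
    have := holder_dual ρ hρ _ v (measurable_const.indicator measurableSet_ball) hv hb
    refine ne_top_of_le_ne_top (ENNReal.mul_ne_top hb hvt) (le_trans (le_of_eq ?_) this)
    rw [← lintegral_indicator measurableSet_ball]
    refine lintegral_congr fun x => ?_
    by_cases hx : x ∈ Metric.ball c s <;> simp [Set.indicator, hx]
  have hMu' : ∀ x, HLM u x ≤ A * u x := fun x => (hMu x).trans (by gcongr; exact le_self_add)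
  have hMv' : ∀ x, HLM v x ≤ A * v x := fun x => (hMv x).trans (by gcongr; exact le_add_self)
  obtain ⟨wae, wA⟩ := Ar_of_A1 r hr A hA0 hAt u v hu hv u0 v0 ut vt hMu' hMv'
  have uae := ae_fin u hu ut
  have vae := ae_fin v hv vt
  set w : Eucl n → ℝ≥0∞ := fun x => u x ^ (-(r-1)) * v x with hw
  have hwm : Measurable w := by fun_prop
  have HW := H0 w hwm wae wA
  set P := ∫⁻ x, u x * v x with hP
  have hpow : ∀ a : ℝ≥0∞, (a ^ (1/r)) ^ r = a := by
    intro a; rw [← ENNReal.rpow_mul]; simp [hr0.ne']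
  have s1 : ∫⁻ x, F x ^ r * w x ≤ C0 * P := by
    calc ∫⁻ x, F x ^ r * w x = ∑' j, ∫⁻ x, HLM (f j) x ^ r * w x := by
          rw [← lintegral_tsum (f := fun j x => HLM (f j) x ^ r * w x) fun j => (((HLM_meas (f j)).pow_const r).mul hwm).aemeasurable]
          refine lintegral_congr fun x => ?_
          simp only [hFdef, hpow, ENNReal.tsum_mul_right]
      _ ≤ ∑' j, C0 * ∫⁻ x, f j x ^ r * w x := ENNReal.tsum_le_tsum fun j => HW (f j) (hf j)
      _ = C0 * ∫⁻ x, G x ^ r * w x := by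
          rw [ENNReal.tsum_mul_left, ← lintegral_tsum (f := fun j x => f j x ^ r * w x) fun j => (((hf j).pow_const r).mul hwm).aemeasurable]
          congr 1
          refine lintegral_congr fun x => ?_
          simp only [hG, hpow, ENNReal.tsum_mul_right]
      _ ≤ C0 * P := by
          refine mul_le_mul_right (lintegral_mono_ae ?_) _
          filter_upwards [uae] with x hx
          calc G x ^ r * w x ≤ u x ^ r * w x := by gcongr; exact hGu x
            _ = u x * v x := by
              simp only [hw]
              rw [← mul_assoc, ← ENNReal.rpow_add _ _ (u0 x).ne' hx,
                show r + -(r-1) = 1 by ring, ENNReal.rpow_one]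
  have hc := Real.HolderConjugate.conjExponent hr
  have hq' : r.conjExponent = r / (r-1) := rfl
  have s2 := ENNReal.lintegral_mul_le_Lp_mul_Lq volume hc
      (f := fun x => F x * w x ^ (1/r)) (g := fun x => (u x * v x) ^ ((r-1)/r))
      (by fun_prop) (by fun_prop)
  have s3 : ∀ x, (F x * w x ^ (1/r)) ^ r = F x ^ r * w x := by
    intro x; rw [ENNReal.mul_rpow_of_nonneg _ _ hr0.le, hpow (w x)]
  have s4 : ∀ x, ((u x * v x) ^ ((r-1)/r)) ^ r.conjExponent = u x * v x := by
    intro x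
    rw [← ENNReal.rpow_mul, hq', show (r-1)/r * (r/(r-1)) = 1 by (have := hq.ne'; field_simp), ENNReal.rpow_one]
  simp only [s3, s4] at s2
  have s5 : ∫⁻ x, F x * v x = ∫⁻ x, ((fun x => F x * w x ^ (1/r)) * fun x => (u x * v x) ^ ((r-1)/r)) x := by
    refine lintegral_congr_ae ?_
    filter_upwards [uae, vae] with x hx hx'
    simp only [Pi.mul_apply, hw]
    rw [mul_assoc]
    congr 1
    rw [ENNReal.mul_rpow_of_nonneg _ _ (by positivity), ENNReal.mul_rpow_of_nonneg _ _ (by positivity),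
      ← ENNReal.rpow_mul]
    calc v x = u x ^ (-(r-1) * (1/r) + (r-1)/r) * v x ^ (1/r + (r-1)/r) := by
          rw [show -(r-1) * (1/r) + (r-1)/r = 0 by ring,
            show 1/r + (r-1)/r = 1 by field_simp; ring]
          simp
      _ = _ := by
          rw [ENNReal.rpow_add _ _ (u0 x).ne' hx, ENNReal.rpow_add _ _ (v0 x).ne' hx']
          ring
  have hPle : P ≤ ρ u * kdual n ρ v := holder_dual ρ hρ u v hu hv hut
  calc ∫⁻ x, F x * h x ≤ ∫⁻ x, F x * v x := by
        refine lintegral_mono fun x => ?_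
        exact mul_le_mul_right (hhv x) _
    _ ≤ (∫⁻ x, F x ^ r * w x) ^ (1/r) * P ^ (1/r.conjExponent) := by rw [s5]; exact s2
    _ ≤ (C0 * P) ^ (1/r) * P ^ (1/r.conjExponent) := by gcongr
    _ = C0 ^ (1/r) * P := by
        rw [ENNReal.mul_rpow_of_nonneg _ _ (by positivity), mul_assoc,
          ← ENNReal.rpow_add_of_nonneg _ _ (by positivity) (by rw [hq']; positivity), hq',
          show 1/r + 1/(r/(r-1)) = 1 by field_simp; ring, ENNReal.rpow_one]
    _ ≤ C0 ^ (1/r) * ((2 * ρ G) * (2 * kdual n ρ h)) := by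
        gcongr
        exact hPle.trans (mul_le_mul' hNu hNv)
    _ = _ := by ring

/-- **Vector-valued maximal inequality (Example 3.7).** -/
theorem vector_valued_maximal (n : ℕ) (hn : 1 ≤ n) (r : ℝ) (hr : 1 < r)
    (ρ : (Eucl n → ℝ≥0∞) → ℝ≥0∞) (hρ : IsBBFN n ρ)
    (hM : MBddOn n ρ) (hM' : MBddOn n (kdual n ρ)) :
    ∃ C : ℝ, 0 < C ∧ ∀ f : ℕ → Eucl n → ℝ, (∀ j, Measurable (f j)) →
      ρ (fun x => (∑' j : ℕ, HLM (fun y => (‖f j y‖₊ : ℝ≥0∞)) x ^ r) ^ (1/r)) ≤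
        ENNReal.ofReal C *
          ρ (fun x => (∑' j : ℕ, (‖f j x‖₊ : ℝ≥0∞) ^ r) ^ (1/r)) := by
  have hr0 : 0 < r := by linarith
  obtain ⟨B, hB, HB⟩ := core_est n r hr ρ hρ hM hM'
  have hC : 0 < B.toReal + 1 := by positivity
  have hBC : B ≤ ENNReal.ofReal (B.toReal + 1) :=
    (ENNReal.le_ofReal_iff_toReal_le hB hC.le).2 (by linarith)
  refine ⟨B.toReal + 1, hC, ?_⟩
  intro f hf
  have hf' : ∀ j, Measurable fun y => (‖f j y‖₊ : ℝ≥0∞) := fun j => (hf j).nnnorm.coe_nnreal_ennreal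
  have H := HB (fun j y => (‖f j y‖₊ : ℝ≥0∞)) hf'
  set G : Eucl n → ℝ≥0∞ := fun x => (∑' j : ℕ, (‖f j x‖₊ : ℝ≥0∞) ^ r) ^ (1/r) with hG
  set F : Eucl n → ℝ≥0∞ :=
    fun x => (∑' j : ℕ, HLM (fun y => (‖f j y‖₊ : ℝ≥0∞)) x ^ r) ^ (1/r) with hF
  have hGm : Measurable G := (Measurable.tsum fun j => (hf' j).pow_const r).pow_const _
  have hFm : Measurable F := (Measurable.tsum fun j => (HLM_meas _).pow_const r).pow_const _
  have hCp : ENNReal.ofReal (B.toReal + 1) ≠ 0 := by simpa using hC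
  by_cases hGt : ρ G = ⊤
  · rw [hGt, ENNReal.mul_top hCp]; exact le_top
  by_cases hG0 : ρ G = 0
  · have h1 := (hρ.zero_iff G hGm).1 hG0
    have h2 : ∀ j, (fun y => (‖f j y‖₊ : ℝ≥0∞)) =ᵐ[volume] 0 := by
      intro j
      filter_upwards [h1] with x hx
      have h3 : (∑' j : ℕ, (‖f j x‖₊ : ℝ≥0∞) ^ r) ^ (1/r) = 0 := hx
      rw [ENNReal.rpow_eq_zero_iff_of_pos (by positivity), ENNReal.tsum_eq_zero] at h3
      have h4 := h3 j
      rw [ENNReal.rpow_eq_zero_iff_of_pos hr0] at h4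
      exact h4
    have h3 : ∀ j x, HLM (fun y => (‖f j y‖₊ : ℝ≥0∞)) x = 0 := by
      intro j x
      refine le_antisymm (iSup₂_le fun s hs => ?_) bot_le
      rw [lintegral_congr_ae (ae_restrict_of_ae (h2 j))]
      simp
    have h4 : F = 0 := by
      funext x
      simp [hF, h3, ENNReal.zero_rpow_of_pos hr0, ENNReal.zero_rpow_of_pos (inv_pos.2 hr0)]
    have h5 : ρ F = 0 := by
      rw [hρ.zero_iff F hFm, h4]
    rw [h5]; exact bot_le
  by_contra hcon
  push Not at hcon
  set t := ENNReal.ofReal (B.toReal + 1) * ρ G with ht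
  have ht0 : t ≠ 0 := mul_ne_zero hCp hG0
  have htt : t ≠ ⊤ := ENNReal.mul_ne_top (by simp) hGt
  obtain ⟨a, ha⟩ : ∃ a : ℝ≥0, (a : ℝ≥0∞) = t⁻¹ :=
    ⟨(t⁻¹).toNNReal, ENNReal.coe_toNNReal (by simpa using ht0)⟩
  have h1 : 1 < ρ (fun x => (a : ℝ≥0∞) * F x) := by
    rw [hρ.smul a F hFm, ha, ← ENNReal.inv_mul_cancel ht0 htt]
    exact ENNReal.mul_lt_mul_right (by simpa using htt) (by simpa using ht0) hcon
  obtain ⟨h, s, hh, hks, hs⟩ := lux ρ hρ _ (hFm.const_mul _) h1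
  have hkt : kdual n ρ h ≠ ⊤ := ne_top_of_le_ne_top (ne_top_of_lt hs) hks
  have h2 := H hG0 hGt h hh hkt
  have h3 : ∫⁻ x, (a : ℝ≥0∞) * F x * h x = t⁻¹ * ∫⁻ x, F x * h x := by
    rw [← ha, ← lintegral_const_mul (f := fun x => F x * h x) _ (hFm.mul hh)]
    refine lintegral_congr fun x => ?_
    ring
  rw [h3] at hs
  refine lt_irrefl s (hs.trans_le ?_)
  calc t⁻¹ * ∫⁻ x, F x * h x ≤ t⁻¹ * (t * kdual n ρ h) := by
        refine mul_le_mul_right (h2.trans ?_) _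
        rw [ht]
        gcongr
    _ = kdual n ρ h := by rw [← mul_assoc, ENNReal.inv_mul_cancel ht0 htt, one_mul]
    _ ≤ s := hks
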